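/- arXiv:2210.06415 — 2 statements merged into one kernel-verified Lean document; each statement's English description precedes it below -/
import Mathlib

section
/- Let v ∈ ℝ² be a vector which is either vertical (first component zero) or has rational slope. Then there exists a matrix M ∈ SL₂(ℤ) such that Mv lies in the nonnegative x-axis ℝ≥0 × {0}; moreover, there exists a unique ℓ ≥ 0 such that Mv = (ℓ, 0) for every M ∈ SL₂(ℤ) with Mv in the nonnegative x-axis. -/
/-- The action of `SL₂(ℤ)` on `ℝ²` by matrix-vector multiplication. -/
noncomputable def sl2Apply (M : Matrix.SpecialLinearGroup (Fin 2) ℤ) (x : Fin 2 → ℝ) :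
    Fin 2 → ℝ :=
  ((M : Matrix (Fin 2) (Fin 2) ℤ).map (Int.cast : ℤ → ℝ)).mulVec x

theorem sl2Apply_zero (M : Matrix.SpecialLinearGroup (Fin 2) ℤ) (x : Fin 2 → ℝ) :
    sl2Apply M x 0 = (M.1 0 0 : ℝ) * x 0 + (M.1 0 1 : ℝ) * x 1 := by
  simp [sl2Apply, Matrix.mulVec, dotProduct, Fin.sum_univ_two]

theorem sl2Apply_one (M : Matrix.SpecialLinearGroup (Fin 2) ℤ) (x : Fin 2 → ℝ) :
    sl2Apply M x 1 = (M.1 1 0 : ℝ) * x 0 + (M.1 1 1 : ℝ) * x 1 := by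
  simp [sl2Apply, Matrix.mulVec, dotProduct, Fin.sum_univ_two]

/-- A vertical vector or one of rational slope is a nonnegative multiple of a primitive
integer vector. -/
theorem exists_nonneg_mul_isCoprime (v : Fin 2 → ℝ)
    (hv : v 0 = 0 ∨ ∃ q : ℚ, v 1 = (q : ℝ) * v 0) :
    ∃ (t : ℝ) (a b : ℤ), 0 ≤ t ∧ IsCoprime a b ∧ v 0 = t * a ∧ v 1 = t * b := by
  have key : ∃ (t : ℝ) (a b : ℤ), IsCoprime a b ∧ v 0 = t * a ∧ v 1 = t * b := by
    rcases hv with h | ⟨q, h⟩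
    · exact ⟨v 1, 0, 1, isCoprime_one_right, by simp [h], by simp⟩
    · have hd : (q.den : ℝ) ≠ 0 := by exact_mod_cast q.den_nz
      refine ⟨v 0 / q.den, q.den, q.num, ?_, ?_, ?_⟩
      · exact (Rat.isCoprime_num_den q).symm
      · push_cast
        field_simp
      · rw [h, Rat.cast_def]
        field_simp
  obtain ⟨t, a, b, hab, h0, h1⟩ := key
  rcases le_total 0 t with ht | ht
  · exact ⟨t, a, b, ht, hab, h0, h1⟩
  · exact ⟨-t, -a, -b, by linarith, hab.neg_neg, by simp [h0], by simp [h1]⟩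

/-- If `M ∈ SL₂(ℤ)` sends a nonnegative multiple `t • (a, b)` of a primitive integer vector into
the nonnegative `x`-axis, then the image is `(t, 0)`. -/
theorem sl2Apply_eq_of_isCoprime {v : Fin 2 → ℝ} {t : ℝ} {a b : ℤ} (ht : 0 ≤ t)
    (hab : IsCoprime a b) (h0 : v 0 = t * a) (h1 : v 1 = t * b)
    (M : Matrix.SpecialLinearGroup (Fin 2) ℤ)
    (hM1 : sl2Apply M v 1 = 0) (hM0 : 0 ≤ sl2Apply M v 0) : sl2Apply M v = ![t, 0] := by
  have hx : sl2Apply M v 0 = t := by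
    have hdet := M.2
    rw [Matrix.det_fin_two] at hdet
    rw [sl2Apply_one, h0, h1] at hM1
    rw [sl2Apply_zero, h0, h1] at hM0 ⊢
    generalize M.1 0 0 = p at *
    generalize M.1 0 1 = q at *
    generalize M.1 1 0 = r at *
    generalize M.1 1 1 = s at *
    rcases ht.eq_or_lt with rfl | ht
    · simp
    · have hz : r * a + s * b = 0 := by
        have : t * ((r * a + s * b : ℤ) : ℝ) = 0 := by push_cast; linarith
        exact_mod_cast (mul_eq_zero.mp this).resolve_left ht.ne'
      have hk : 0 ≤ p * a + q * b := by
        have : 0 ≤ t * ((p * a + q * b : ℤ) : ℝ) := by push_cast; linarith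
        exact_mod_cast nonneg_of_mul_nonneg_right this ht
      have ⟨u, w, huw⟩ := hab
      have hunit : (p * a + q * b) * (u * s - w * r) = 1 := by
        linear_combination (u * a + w * b) * hdet + huw + (u * q - w * p) * hz
      have hk1 : p * a + q * b = 1 := Int.eq_one_of_mul_eq_one_right hk hunit
      have hk2 : (p : ℝ) * a + q * b = 1 := by exact_mod_cast hk1
      linear_combination t * hk2
  ext i
  fin_cases i
  · exact hx
  · exact hM1

/-- If `v ∈ ℝ²` is vertical (first component zero) or has rational slope,
then some `M ∈ SL₂(ℤ)` sends `v` into the nonnegative `x`-axis, and there is a unique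
`ℓ ≥ 0` with `M v = (ℓ, 0)` for every such `M`. -/
theorem stmt0 (v : Fin 2 → ℝ) (hv : v 0 = 0 ∨ ∃ q : ℚ, v 1 = (q : ℝ) * v 0) :
    (∃ M : Matrix.SpecialLinearGroup (Fin 2) ℤ,
        sl2Apply M v 1 = 0 ∧ 0 ≤ sl2Apply M v 0) ∧
    (∃! ℓ : ℝ, 0 ≤ ℓ ∧
        ∀ M : Matrix.SpecialLinearGroup (Fin 2) ℤ,
          (sl2Apply M v 1 = 0 ∧ 0 ≤ sl2Apply M v 0) → sl2Apply M v = ![ℓ, 0]) := by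
  obtain ⟨t, a, b, ht, hab, h0, h1⟩ := exists_nonneg_mul_isCoprime v hv
  have hex : ∃ M : Matrix.SpecialLinearGroup (Fin 2) ℤ,
      sl2Apply M v 1 = 0 ∧ 0 ≤ sl2Apply M v 0 := by
    have ⟨u, w, huw⟩ := hab
    obtain ⟨M, hM⟩ : ∃ M : Matrix.SpecialLinearGroup (Fin 2) ℤ, M.1 = !![u, w; -b, a] :=
      ⟨⟨!![u, w; -b, a], by rw [Matrix.det_fin_two_of]; linarith⟩, rfl⟩
    refine ⟨M, ?_, ?_⟩
    · rw [sl2Apply_one, h0, h1, hM]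
      simp
      ring
    · have huw' : (u : ℝ) * a + w * b = 1 := by exact_mod_cast huw
      rw [sl2Apply_zero, h0, h1, hM]
      simp only [Matrix.of_apply, Matrix.cons_val', Matrix.cons_val_zero, Matrix.cons_val_one,
        Matrix.cons_val_fin_one]
      linear_combination ht - t * huw'
  refine ⟨hex, t, ⟨ht, fun M hM => sl2Apply_eq_of_isCoprime ht hab h0 h1 M hM.1 hM.2⟩, ?_⟩
  rintro l ⟨-, hl⟩
  obtain ⟨M, hM⟩ := hex
  have h := (hl M hM).symm.trans (sl2Apply_eq_of_isCoprime ht hab h0 h1 M hM.1 hM.2)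
  simpa using congrFun h 0
end

section
/- Let a, b > 0 and let n be a positive integer. Let K = {(λ₁, λ₂, λ₃, λ₄) ∈ ℝ⁴ : λᵢ ≥ 0 for all i, λ₁+λ₂ ≤ a, λ₂+λ₃ ≤ b, λ₃+λ₄ ≤ a, λ₄+λ₁ ≤ na+b}. Then the maximum of λ₁² + λ₂² + λ₃² + λ₄² over K equals: 2a² if n > 1; 2a² if n = 1 and a ≤ b; a² + b² + (a−b)² if n = 1 and b < a < 2b; and a² + 2b² if n = 1 and a ≥ 2b. -/
lemma sq_add_sq_le_sq_of_add_le {u v p : ℝ} (hu : 0 ≤ u) (hv : 0 ≤ v) (h : u + v ≤ p) :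
    u ^ 2 + v ^ 2 ≤ p ^ 2 := by
  nlinarith [mul_nonneg hu hv, pow_le_pow_left₀ (add_nonneg hu hv) h 2]

/-- If `u, v ≤ p` and `u + v ≤ p + q`, then `(p, q)` majorizes `(u, v)`. -/
lemma sq_add_sq_le_of_majorized {u v p q : ℝ} (hu : 0 ≤ u) (hv : 0 ≤ v) (hup : u ≤ p)
    (hvp : v ≤ p) (h : u + v ≤ p + q) : u ^ 2 + v ^ 2 ≤ p ^ 2 + q ^ 2 := by
  rcases le_total (u + v) p with h' | h'
  · linarith [sq_add_sq_le_sq_of_add_le hu hv h', sq_nonneg q]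
  · nlinarith [mul_nonneg (sub_nonneg.2 hup) (sub_nonneg.2 hvp),
      pow_le_pow_left₀ (sub_nonneg.2 h') (by linarith : u + v - p ≤ q) 2]

lemma sum_sq_le_of_lt_two_mul_of_le {a b x y z w : ℝ} (hba : b < a) (hab : a < 2 * b)
    (hx : 0 ≤ x) (hy : 0 ≤ y) (hz : 0 ≤ z) (hw : 0 ≤ w) (hxy : x + y ≤ a) (hyz : y + z ≤ b)
    (hzw : z + w ≤ a) (hwx : w + x ≤ a + b) (h : w ≤ x) :
    x ^ 2 + y ^ 2 + z ^ 2 + w ^ 2 ≤ a ^ 2 + b ^ 2 + (a - b) ^ 2 := by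
  have hW : 0 ≤ min (b + y) (a - z) := le_min (by linarith) (by linarith)
  have hxw : x + w ≤ (a - y) + min (b + y) (a - z) := by
    rw [← min_add_add_left]
    exact le_min (by linarith) (by linarith)
  have h₁ := sq_add_sq_le_of_majorized hx hw (by linarith : x ≤ a - y) (by linarith) hxw
  have hWy := min_le_left (b + y) (a - z)
  have hWz := min_le_right (b + y) (a - z)
  rcases le_total (b + y) a with hya | hya
  · have h₂ := sq_add_sq_le_of_majorized hz hW (by linarith : z ≤ b + y) hWy
      (by linarith : _ ≤ _ + (a - b - y))
    nlinarith [mul_nonneg hy (by linarith : 0 ≤ a - b - y)]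
  · have h₂ := sq_add_sq_le_sq_of_add_le hz hW (by linarith : _ ≤ a)
    nlinarith [mul_nonneg (by linarith : 0 ≤ b - y) (by linarith : 0 ≤ y - (a - b))]

lemma sum_sq_le_of_two_mul_le_of_le {a b x y z w : ℝ} (hab : 2 * b ≤ a)
    (hx : 0 ≤ x) (hy : 0 ≤ y) (hz : 0 ≤ z) (hw : 0 ≤ w) (hxy : x + y ≤ a) (hyz : y + z ≤ b)
    (hwx : w + x ≤ a + b) (h : w ≤ x) :
    x ^ 2 + y ^ 2 + z ^ 2 + w ^ 2 ≤ a ^ 2 + 2 * b ^ 2 := by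
  have h₁ := sq_add_sq_le_of_majorized hx hw (by linarith : x ≤ a - y) (by linarith)
    (by linarith : _ ≤ _ + (b + y))
  have h₂ := pow_le_pow_left₀ hz (by linarith : z ≤ b - y) 2
  nlinarith [mul_nonneg hy (by linarith : 0 ≤ a - 2 * y)]

/-- The maximum of `λ₁² + λ₂² + λ₃² + λ₄²` over the compact convex set
`K = {λ ∈ ℝ⁴ : λᵢ ≥ 0, λ₁+λ₂ ≤ a, λ₂+λ₃ ≤ b, λ₃+λ₄ ≤ a, λ₄+λ₁ ≤ na+b}`,
for `a, b > 0` and `n` a positive integer. -/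
theorem stmt9 (a b : ℝ) (n : ℤ) (ha : 0 < a) (hb : 0 < b) (hn : 0 < n) :
    (1 < n → IsGreatest
      {s : ℝ | ∃ l : Fin 4 → ℝ, (∀ i, 0 ≤ l i) ∧ l 0 + l 1 ≤ a ∧ l 1 + l 2 ≤ b ∧
        l 2 + l 3 ≤ a ∧ l 3 + l 0 ≤ (n : ℝ) * a + b ∧
        s = l 0 ^ 2 + l 1 ^ 2 + l 2 ^ 2 + l 3 ^ 2}
      (2 * a ^ 2)) ∧
    (n = 1 → a ≤ b → IsGreatest
      {s : ℝ | ∃ l : Fin 4 → ℝ, (∀ i, 0 ≤ l i) ∧ l 0 + l 1 ≤ a ∧ l 1 + l 2 ≤ b ∧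
        l 2 + l 3 ≤ a ∧ l 3 + l 0 ≤ (n : ℝ) * a + b ∧
        s = l 0 ^ 2 + l 1 ^ 2 + l 2 ^ 2 + l 3 ^ 2}
      (2 * a ^ 2)) ∧
    (n = 1 → b < a → a < 2 * b → IsGreatest
      {s : ℝ | ∃ l : Fin 4 → ℝ, (∀ i, 0 ≤ l i) ∧ l 0 + l 1 ≤ a ∧ l 1 + l 2 ≤ b ∧
        l 2 + l 3 ≤ a ∧ l 3 + l 0 ≤ (n : ℝ) * a + b ∧
        s = l 0 ^ 2 + l 1 ^ 2 + l 2 ^ 2 + l 3 ^ 2}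
      (a ^ 2 + b ^ 2 + (a - b) ^ 2)) ∧
    (n = 1 → 2 * b ≤ a → IsGreatest
      {s : ℝ | ∃ l : Fin 4 → ℝ, (∀ i, 0 ≤ l i) ∧ l 0 + l 1 ≤ a ∧ l 1 + l 2 ≤ b ∧
        l 2 + l 3 ≤ a ∧ l 3 + l 0 ≤ (n : ℝ) * a + b ∧
        s = l 0 ^ 2 + l 1 ^ 2 + l 2 ^ 2 + l 3 ^ 2}
      (a ^ 2 + 2 * b ^ 2)) := by
  refine ⟨fun hn₁ ↦ ⟨⟨![a, 0, 0, a], ?_⟩, ?_⟩, ?_, ?_, ?_⟩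
  · have hn₂ : (2 : ℝ) ≤ n := by exact_mod_cast hn₁
    have hna : 2 * a ≤ n * a := by gcongr
    simp [Fin.forall_fin_succ]
    refine ⟨ha.le, hb.le, ?_, ?_⟩ <;> linarith
  · rintro s ⟨l, hl, h₀₁, -, h₂₃, -, rfl⟩
    linarith [sq_add_sq_le_sq_of_add_le (hl 0) (hl 1) h₀₁,
      sq_add_sq_le_sq_of_add_le (hl 2) (hl 3) h₂₃]
  · rintro rfl hab
    refine ⟨⟨![a, 0, 0, a], ?_⟩, ?_⟩
    · simp [Fin.forall_fin_succ]
      refine ⟨ha.le, hb.le, ?_, ?_⟩ <;> linarith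
    · rintro s ⟨l, hl, h₀₁, -, h₂₃, -, rfl⟩
      linarith [sq_add_sq_le_sq_of_add_le (hl 0) (hl 1) h₀₁,
        sq_add_sq_le_sq_of_add_le (hl 2) (hl 3) h₂₃]
  · rintro rfl hba hab
    refine ⟨⟨![a, 0, a - b, b], ?_⟩, ?_⟩
    · simp [Fin.forall_fin_succ]
      refine ⟨⟨?_, ?_, ?_⟩, ?_, ?_, ?_⟩ <;> linarith
    · rintro s ⟨l, hl, h₀₁, h₁₂, h₂₃, h₃₀, rfl⟩
      rw [Int.cast_one, one_mul] at h₃₀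
      rcases le_total (l 3) (l 0) with h | h
      · exact sum_sq_le_of_lt_two_mul_of_le hba hab (hl 0) (hl 1) (hl 2) (hl 3) h₀₁ h₁₂ h₂₃ h₃₀ h
      · linarith [sum_sq_le_of_lt_two_mul_of_le hba hab (hl 3) (hl 2) (hl 1) (hl 0)
          (by linarith) (by linarith) (by linarith) (by linarith) h]
  · rintro rfl hab
    refine ⟨⟨![a, 0, b, b], ?_⟩, ?_⟩
    · simp [Fin.forall_fin_succ]
      refine ⟨⟨?_, ?_⟩, ?_, ?_, ?_⟩ <;> linarith
    · rintro s ⟨l, hl, h₀₁, h₁₂, h₂₃, h₃₀, rfl⟩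
      rw [Int.cast_one, one_mul] at h₃₀
      rcases le_total (l 3) (l 0) with h | h
      · exact sum_sq_le_of_two_mul_le_of_le hab (hl 0) (hl 1) (hl 2) (hl 3) h₀₁ h₁₂ h₃₀ h
      · linarith [sum_sq_le_of_two_mul_le_of_le hab (hl 3) (hl 2) (hl 1) (hl 0)
          (by linarith) (by linarith) (by linarith) h]
end
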